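/- arXiv:1910.00802 — 3 statements merged into one kernel-verified Lean document; each statement's English description precedes it below -/
import Mathlib

section
/- Let n ≥ 1, let s ∈ 𝔽₂ⁿ be nonzero, let i be an index with s_i = 1, and define f_s : 𝔽₂ⁿ → 𝔽₂ⁿ by f_s(x) = x + x_i • s. If g : 𝔽₂ⁿ → 𝔽₂ⁿ is any Simon function with period s, then there exists a bijection P : 𝔽₂ⁿ → 𝔽₂ⁿ such that g = P ∘ f_s. -/
theorem simon_function_general_form (n : ℕ) (hn : 1 ≤ n) (s : Fin n → ZMod 2)
    (hs : s ≠ 0) (i : Fin n) (hi : s i = 1)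
    (g : (Fin n → ZMod 2) → (Fin n → ZMod 2))
    (hg : ∀ x y : Fin n → ZMod 2, g x = g y ↔ (y = x ∨ y = x + s)) :
    ∃ P : (Fin n → ZMod 2) → (Fin n → ZMod 2),
      Function.Bijective P ∧ g = P ∘ (fun x => x + (x i) • s) := by
  have hinj : Set.InjOn g {x | x i = 0} := by
    intro x hx y hy h
    rcases (hg x y).1 h with h | h
    · exact h.symm
    · exfalso
      have h2 := congrFun h i
      simp only [Set.mem_setOf_eq] at hx hy
      rw [Pi.add_apply, hx, hy, hi] at h2
      exact absurd h2 (by decide)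
  obtain ⟨e, he⟩ := Set.MapsTo.exists_equiv_extend_of_card_eq
    (α := Fin n → ZMod 2) (t := (Finset.univ : Finset (Fin n → ZMod 2)))
    Finset.card_univ.symm (s := {x | x i = 0}) (f := g) (fun x _ => by simp) hinj
  refine ⟨fun x => (e x : Fin n → ZMod 2), ⟨?_, ?_⟩, ?_⟩
  · intro x y h
    exact e.injective (Subtype.ext h)
  · intro y
    obtain ⟨x, hx⟩ := e.surjective ⟨y, Finset.mem_univ y⟩
    exact ⟨x, by simp [hx]⟩
  · funext x
    have hdich : ∀ a : ZMod 2, a = 0 ∨ a = 1 := by decide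
    have hmem : x + x i • s ∈ {x : Fin n → ZMod 2 | x i = 0} := by
      have h2 : ∀ a : ZMod 2, a + a * 1 = 0 := by decide
      simp only [Set.mem_setOf_eq, Pi.add_apply, Pi.smul_apply, smul_eq_mul, hi]
      exact h2 _
    simp only [Function.comp]
    rw [he _ hmem, hg]
    rcases hdich (x i) with h | h
    · left; rw [h]; simp
    · right; rw [h]; simp
end

section
/- Let n ≥ 1, let s ∈ 𝔽₂ⁿ be nonzero, let τ ∈ [0, 1], and let z ∈ 𝔽₂ⁿ satisfy ⟨z, s⟩ = 1. Draw y from the LSN distribution with parameters s and τ and, independently, draw b uniformly from ZMod 2. Then Pr[⟨y + b • z, s⟩ + b = 1] = τ. -/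
theorem lsn_to_lpn_error_rate (n : ℕ) (hn : 1 ≤ n) (s : Fin n → ZMod 2) (hs : s ≠ 0)
    (τ : ℝ) (hτ0 : 0 ≤ τ) (hτ1 : τ ≤ 1)
    (z : Fin n → ZMod 2) (hz : (∑ j, z j * s j) = 1)
    (D : PMF (Fin n → ZMod 2))
    (hD : ∀ y : Fin n → ZMod 2,
      D y = if (∑ j, y j * s j) = 0 then ENNReal.ofReal ((1 - τ) / 2 ^ (n - 1))
            else ENNReal.ofReal (τ / 2 ^ (n - 1))) :
    (∑' p : (Fin n → ZMod 2) × ZMod 2,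
        if (∑ j, (p.1 + p.2 • z) j * s j) + p.2 = 1 then
          (D.bind (fun y => (PMF.uniformOfFintype (ZMod 2)).map (fun b => (y, b)))) p
        else 0)
      = ENNReal.ofReal τ := by
  have hbind : ∀ (y : Fin n → ZMod 2) (b : ZMod 2),
      (D.bind (fun y => (PMF.uniformOfFintype (ZMod 2)).map (fun b => (y, b)))) (y, b)
        = D y * 2⁻¹ := by
    intro y b
    rw [PMF.bind_apply, tsum_eq_single y]
    · congr 1
      rw [PMF.map_apply, tsum_eq_single b]
      · simp [PMF.uniformOfFintype_apply, ZMod.card]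
      · intro b' hb'
        rw [if_neg]
        intro h
        exact hb' (Prod.ext_iff.mp h).2.symm
    · intro y' hy'
      rw [PMF.map_apply]
      have : ∀ b' : ZMod 2, (y, b) ≠ (y', b') := by
        intro b' h
        exact hy' (Prod.ext_iff.mp h).1.symm
      simp [hy'.symm]
  have hadd : ∀ (y : Fin n → ZMod 2) (b : ZMod 2),
      (∑ j, (y + b • z) j * s j) = (∑ j, y j * s j) + b := by
    intro y b
    have : b * (∑ j, z j * s j) = b := by rw [hz, mul_one]
    conv_rhs => rw [← this]
    rw [Finset.mul_sum, ← Finset.sum_add_distrib]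
    refine Finset.sum_congr rfl fun j _ => ?_
    simp only [Pi.add_apply, Pi.smul_apply, smul_eq_mul]
    ring
  have hbb : ∀ a b : ZMod 2, a + b + b = a := by decide
  have hne : ∀ a : ZMod 2, (a = 1 ↔ ¬ a = 0) := by decide
  have hflip : ∀ a : ZMod 2, (a + 1 = 1 ↔ ¬ a = 1) := by decide
  have hcard : (Finset.univ.filter
      (fun y : Fin n → ZMod 2 => (∑ j, y j * s j) = 1)).card = 2 ^ (n - 1) := by
    have h1 : (Finset.univ.filter (fun y : Fin n → ZMod 2 => (∑ j, y j * s j) = 1)).card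
        = (Finset.univ.filter (fun y : Fin n → ZMod 2 => ¬ (∑ j, y j * s j) = 1)).card := by
      symm
      apply Finset.card_equiv (Equiv.addRight z)
      intro y
      have := hadd y 1
      rw [one_smul] at this
      simp only [Finset.mem_filter, Finset.mem_univ, true_and, Equiv.coe_addRight]
      rw [this, hflip]
    have h2 := Finset.card_filter_add_card_filter_not (s := Finset.univ)
      (fun y : Fin n → ZMod 2 => (∑ j, y j * s j) = 1)
    have h3 : (Finset.univ : Finset (Fin n → ZMod 2)).card = 2 ^ n := by
      simp [ZMod.card]
    have h4 : 2 ^ n = 2 * 2 ^ (n - 1) := by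
      rw [← pow_succ', Nat.sub_add_cancel hn]
    omega
  rw [tsum_fintype, Fintype.sum_prod_type]
  have hinner : ∀ y : Fin n → ZMod 2,
      (∑ b : ZMod 2, if (∑ j, (y + b • z) j * s j) + b = 1 then
          (D.bind (fun y => (PMF.uniformOfFintype (ZMod 2)).map (fun b => (y, b)))) (y, b)
        else 0) = if (∑ j, y j * s j) = 1 then ENNReal.ofReal (τ / 2 ^ (n - 1)) else 0 := by
    intro y
    simp only [hadd, hbb, hbind]
    rw [Finset.sum_const, Finset.card_univ, ZMod.card]
    by_cases h : (∑ j, y j * s j) = 1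
    · rw [if_pos h, if_pos h, hD, if_neg ((hne _).1 h), nsmul_eq_mul, mul_left_comm]
      rw [Nat.cast_ofNat, ENNReal.mul_inv_cancel (by norm_num) (by norm_num), mul_one]
    · rw [if_neg h, if_neg h, smul_zero]
  simp only [hinner]
  rw [← Finset.sum_filter, Finset.sum_const, hcard, ← ENNReal.ofReal_nsmul]
  congr 1
  rw [nsmul_eq_mul]
  push_cast
  field_simp
end

section
/- Let n ≥ 1, let s ∈ 𝔽₂ⁿ be nonzero, let τ ∈ [0, 1], and let z ∈ 𝔽₂ⁿ satisfy ⟨z, s⟩ = 1. Draw y from the LSN distribution with parameters s and τ and, independently, draw b uniformly from ZMod 2. Then the random vector y + b • z is uniformly distributed on 𝔽₂ⁿ: for every v ∈ 𝔽₂ⁿ, Pr[y + b • z = v] = 1/2ⁿ. -/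
theorem map_add_right_apply_aux {n : ℕ} (D : PMF (Fin n → ZMod 2)) (c v : Fin n → ZMod 2) :
    (D.map (fun y => y + c)) v = D (v - c) := by
  classical
  rw [PMF.map_apply, tsum_eq_single (v - c)]
  · simp
  · intro b hb
    rw [if_neg]
    rintro rfl
    simp at hb

theorem lsn_to_lpn_uniform_vector (n : ℕ) (hn : 1 ≤ n) (s : Fin n → ZMod 2) (hs : s ≠ 0)
    (τ : ℝ) (hτ0 : 0 ≤ τ) (hτ1 : τ ≤ 1)
    (z : Fin n → ZMod 2) (hz : (∑ j, z j * s j) = 1)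
    (D : PMF (Fin n → ZMod 2))
    (hD : ∀ y : Fin n → ZMod 2,
      D y = if (∑ j, y j * s j) = 0 then ENNReal.ofReal ((1 - τ) / 2 ^ (n - 1))
            else ENNReal.ofReal (τ / 2 ^ (n - 1))) :
    ∀ v : Fin n → ZMod 2,
      ((D.bind (fun y => (PMF.uniformOfFintype (ZMod 2)).map (fun b => (y, b)))).map
          (fun p => p.1 + p.2 • z)) v = (2 ^ n)⁻¹ := by
  intro v
  have key : ((D.bind (fun y => (PMF.uniformOfFintype (ZMod 2)).map (fun b => (y, b)))).map
      (fun p => p.1 + p.2 • z)) =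
      (PMF.uniformOfFintype (ZMod 2)).bind (fun b => D.map (fun y => y + b • z)) := by
    simp only [← PMF.bind_pure_comp, PMF.bind_bind, Function.comp_def, PMF.pure_bind]
    exact PMF.bind_comm _ _ _
  rw [key, PMF.bind_apply, tsum_fintype]
  simp only [map_add_right_apply_aux, PMF.uniformOfFintype_apply, ZMod.card]
  have hsum : ∀ f : ZMod 2 → ENNReal, ∑ b, f b = f 0 + f 1 := fun f => Fin.sum_univ_two f
  rw [hsum]
  have hin : (∑ j, (v - (1 : ZMod 2) • z) j * s j) = (∑ j, v j * s j) - 1 := by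
    rw [one_smul, ← hz, ← Finset.sum_sub_distrib]
    exact Finset.sum_congr rfl (fun j _ => by simp [sub_mul])
  have h1 : 0 ≤ (1 - τ) / 2 ^ (n - 1) := div_nonneg (by linarith) (by positivity)
  have h2 : 0 ≤ τ / 2 ^ (n - 1) := div_nonneg hτ0 (by positivity)
  have hD2 : D (v - (0 : ZMod 2) • z) + D (v - (1 : ZMod 2) • z)
      = ENNReal.ofReal (1 / 2 ^ (n - 1)) := by
    rw [hD, hD, hin, zero_smul, sub_zero]
    have h01 : ∀ a : ZMod 2, a = 0 ∨ a = 1 := by decide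
    rcases h01 (∑ j, v j * s j) with h | h
    · rw [h, if_pos rfl, if_neg (by decide), ← ENNReal.ofReal_add h1 h2]
      congr 1; ring
    · rw [h, if_neg (by decide), if_pos (by decide), ← ENNReal.ofReal_add h2 h1]
      congr 1; ring
  rw [← mul_add, hD2]
  obtain ⟨m, rfl⟩ : ∃ m, n = m + 1 := ⟨n - 1, by omega⟩
  rw [Nat.add_sub_cancel, one_div, ENNReal.ofReal_inv_of_pos (by positivity),
    ENNReal.ofReal_pow (by norm_num), pow_succ, ENNReal.mul_inv (by simp) (by simp), mul_comm]
  norm_num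
end
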